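/- If the group G and its derived subgroup G' are both finitely generated, then the subgroup L₁₂ = ⁅L₁,L₂⁆ of the weak commutativity group χ(G) is finitely generated. -/

import Mathlib

open Subgroup

/-- The weak commutativity relations inside the free product `G ∗ G`. -/
def chiRel (G : Type*) [Group G] : Subgroup (Monoid.Coprod G G) :=
  Subgroup.normalClosure
    {x | ∃ g : G, x = Monoid.Coprod.inl g * Monoid.Coprod.inr g *
      (Monoid.Coprod.inl g)⁻¹ * (Monoid.Coprod.inr g)⁻¹}

instance chiRel_normal (G : Type*) [Group G] : (chiRel G).Normal :=
  Subgroup.normalClosure_normal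

/-- The weak commutativity group `χ(G)`. -/
def Chi (G : Type*) [Group G] : Type _ := Monoid.Coprod G G ⧸ chiRel G

instance (G : Type*) [Group G] : Group (Chi G) :=
  inferInstanceAs (Group (Monoid.Coprod G G ⧸ chiRel G))

/-- The canonical map `G → χ(G)`, `g ↦ g`. -/
def chiIota1 (G : Type*) [Group G] : G →* Chi G :=
  (QuotientGroup.mk' (chiRel G)).comp Monoid.Coprod.inl

/-- The canonical map `G → χ(G)`, `g ↦ g^φ`. -/
def chiIota2 (G : Type*) [Group G] : G →* Chi G :=
  (QuotientGroup.mk' (chiRel G)).comp Monoid.Coprod.inr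

/-- `G₁ ≤ χ(G)`. -/
def chiG1 (G : Type*) [Group G] : Subgroup (Chi G) := (chiIota1 G).range

/-- `G₂ = G^φ ≤ χ(G)`. -/
def chiG2 (G : Type*) [Group G] : Subgroup (Chi G) := (chiIota2 G).range

/-- `L = ⟨g⁻¹ g^φ : g ∈ G⟩`. -/
def chiL (G : Type*) [Group G] : Subgroup (Chi G) :=
  Subgroup.closure {x | ∃ g : G, x = (chiIota1 G g)⁻¹ * chiIota2 G g}

/-- `D = ⁅G₁, G₂⁆`. -/
def chiD (G : Type*) [Group G] : Subgroup (Chi G) := ⁅chiG1 G, chiG2 G⁆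

/-- `L₁ = ⁅L, G₁⁆`. -/
def chiL1 (G : Type*) [Group G] : Subgroup (Chi G) := ⁅chiL G, chiG1 G⁆

/-- `L₂ = ⁅L, G₂⁆`. -/
def chiL2 (G : Type*) [Group G] : Subgroup (Chi G) := ⁅chiL G, chiG2 G⁆

/-- `R = ⁅⁅G₁, L⁆, G₂⁆`. -/
def chiR (G : Type*) [Group G] : Subgroup (Chi G) := ⁅⁅chiG1 G, chiL G⁆, chiG2 G⁆

/-- `L₁₂ = ⁅L₁, L₂⁆`. -/
def chiL12 (G : Type*) [Group G] : Subgroup (Chi G) := ⁅chiL1 G, chiL2 G⁆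

open scoped commutatorElement

theorem chi_comm (G : Type*) [Group G] (g : G) :
    chiIota1 G g * chiIota2 G g = chiIota2 G g * chiIota1 G g := by
  have h : (QuotientGroup.mk' (chiRel G)) (Monoid.Coprod.inl g * Monoid.Coprod.inr g *
      (Monoid.Coprod.inl g)⁻¹ * (Monoid.Coprod.inr g)⁻¹) = 1 :=
    (QuotientGroup.eq_one_iff _).2 (Subgroup.subset_normalClosure ⟨g, rfl⟩)
  rw [map_mul, map_mul, map_mul, map_inv, map_inv, mul_inv_eq_one, mul_inv_eq_iff_eq_mul] at h
  exact h

theorem chi_hom_ext {G H : Type*} [Group G] [Group H] {f k : Chi G →* H}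
    (h1 : ∀ g, f (chiIota1 G g) = k (chiIota1 G g))
    (h2 : ∀ g, f (chiIota2 G g) = k (chiIota2 G g)) : f = k := by
  have : f.comp (QuotientGroup.mk' (chiRel G)) = k.comp (QuotientGroup.mk' (chiRel G)) :=
    Monoid.Coprod.hom_ext (MonoidHom.ext h1) (MonoidHom.ext h2)
  ext x
  obtain ⟨y, rfl⟩ := QuotientGroup.mk'_surjective (chiRel G) x
  exact DFunLike.congr_fun this y

theorem chi_lift_exists {G H : Type*} [Group G] [Group H] (a b : G →* H)
    (hab : ∀ g, a g * b g = b g * a g) :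
    ∃ f : Chi G →* H, (∀ g, f (chiIota1 G g) = a g) ∧ (∀ g, f (chiIota2 G g) = b g) := by
  have hle : chiRel G ≤ (Monoid.Coprod.lift a b).ker := by
    refine Subgroup.normalClosure_le_normal ?_
    rintro x ⟨g, rfl⟩
    change Monoid.Coprod.lift a b _ = 1
    simp [hab]
  refine ⟨QuotientGroup.lift (chiRel G) (Monoid.Coprod.lift a b) hle, fun g => ?_, fun g => ?_⟩
  · exact Monoid.Coprod.lift_apply_inl a b g
  · exact Monoid.Coprod.lift_apply_inr a b g

theorem chi_closure (G : Type*) [Group G] : chiG1 G ⊔ chiG2 G = ⊤ := by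
  rw [eq_top_iff]
  intro x _
  obtain ⟨y, rfl⟩ := QuotientGroup.mk'_surjective (chiRel G) x
  induction y using Monoid.Coprod.induction_on with
  | inl g => exact Subgroup.mem_sup_left ⟨g, rfl⟩
  | inr g => exact Subgroup.mem_sup_right ⟨g, rfl⟩
  | mul a b ha hb => 
    rw [map_mul]
    exact Subgroup.mul_mem _ (ha trivial) (hb trivial)

theorem conj_comm_left {X : Type*} [Group X] (k g h : X) :
    k * ⁅g, h⁆ * k⁻¹ = ⁅k * g, h⁆ * ⁅k, h⁆⁻¹ := by
  simp only [commutatorElement_def]; group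

theorem conj_comm_right {X : Type*} [Group X] (k g h : X) :
    k * ⁅g, h⁆ * k⁻¹ = ⁅g, k⁆⁻¹ * ⁅g, k * h⁆ := by
  simp only [commutatorElement_def]; group

theorem commutator_le_normalizer {X : Type*} [Group X] (A B : Subgroup X) (k : X)
    (h : ∀ k', k' = k ∨ k' = k⁻¹ → ∀ a ∈ A, ∀ b ∈ B, k' * ⁅a, b⁆ * k'⁻¹ ∈ ⁅A, B⁆) :
    k ∈ Subgroup.normalizer (⁅A, B⁆ : Subgroup X) := by
  have key : ∀ k', k' = k ∨ k' = k⁻¹ → ∀ x ∈ ⁅A, B⁆, k' * x * k'⁻¹ ∈ ⁅A, B⁆ := by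
    intro k' hk' x hx
    have : ⁅A, B⁆ ≤ (⁅A, B⁆).comap (MulAut.conj k').toMonoidHom :=
      Subgroup.commutator_le.2 fun a ha b hb => h k' hk' a ha b hb
    exact this hx
  rw [Subgroup.mem_normalizer_iff]
  intro x
  refine ⟨key k (Or.inl rfl) x, fun hx => ?_⟩
  have := key k⁻¹ (Or.inr rfl) _ hx
  simpa [mul_assoc] using this

theorem chiD_normal (G : Type*) [Group G] : (chiD G).Normal := by
  rw [← Subgroup.normalizer_eq_top_iff, eq_top_iff, ← chi_closure, sup_le_iff]
  constructor
  · intro k hk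
    refine commutator_le_normalizer _ _ k fun k' hk' a ha b hb => ?_
    have hk'' : k' ∈ chiG1 G := by rcases hk' with rfl | rfl <;> simpa using hk
    rw [conj_comm_left]
    exact Subgroup.mul_mem _ (Subgroup.commutator_mem_commutator (mul_mem hk'' ha) hb)
      (inv_mem (Subgroup.commutator_mem_commutator hk'' hb))
  · intro k hk
    refine commutator_le_normalizer _ _ k fun k' hk' a ha b hb => ?_
    have hk'' : k' ∈ chiG2 G := by rcases hk' with rfl | rfl <;> simpa using hk
    rw [conj_comm_right]
    exact Subgroup.mul_mem _ (inv_mem (Subgroup.commutator_mem_commutator ha hk''))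
      (Subgroup.commutator_mem_commutator ha (mul_mem (hk'') (hb)))

/-- `[g^φ, h] = [g, h^φ]`. -/
theorem chi_swap {G : Type*} [Group G] (g h : G) :
    ⁅chiIota2 G g, chiIota1 G h⁆ = ⁅chiIota1 G g, chiIota2 G h⁆ := by
  have e := chi_comm G (g⁻¹ * h)
  have hg := chi_comm G g
  have hh := chi_comm G h
  simp only [map_mul, map_inv] at e
  generalize chiIota1 G g = a at *
  generalize chiIota2 G g = a' at *
  generalize chiIota1 G h = b at *
  generalize chiIota2 G h = b' at *
  simp only [commutatorElement_def]
  have hg2 : a' * a⁻¹ = a⁻¹ * a' := by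
    rw [mul_inv_eq_iff_eq_mul, mul_assoc, ← hg]; group
  have hh2 : b' * b⁻¹ = b⁻¹ * b' := by
    rw [mul_inv_eq_iff_eq_mul, mul_assoc, ← hh]; group
  have e2 : a' * b * a'⁻¹ * b' = a * b' * a⁻¹ * b := by
    calc a' * b * a'⁻¹ * b' = a' * a * (a⁻¹ * b * (a'⁻¹ * b')) := by group
      _ = a' * a * (a'⁻¹ * b' * (a⁻¹ * b)) := by rw [e]
      _ = (a * a') * (a'⁻¹ * b' * (a⁻¹ * b)) := by rw [hg]
      _ = _ := by group
  calc a' * b * a'⁻¹ * b⁻¹ = (a' * b * a'⁻¹ * b') * (b * b')⁻¹ := by group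
    _ = (a * b' * a⁻¹ * b) * (b' * b)⁻¹ := by rw [e2, hh]
    _ = (a * b' * a⁻¹) * (b * b⁻¹) * b'⁻¹ := by group
    _ = _ := by group

theorem chi_L_comm_D {G : Type*} [Group G] {x y : Chi G} (hx : x ∈ chiL G) (hy : y ∈ chiD G) :
    x * y = y * x := by
  suffices h : chiD G ≤ Subgroup.centralizer (chiL G : Set (Chi G)) from
    Subgroup.mem_centralizer_iff.1 (h hy) x hx
  refine Subgroup.commutator_le.2 ?_
  rintro _ ⟨g, rfl⟩ _ ⟨h, rfl⟩
  rw [chiL, Subgroup.centralizer_closure, Subgroup.mem_centralizer_iff]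
  rintro _ ⟨k, rfl⟩
  have e1 := chi_swap g (k * h)
  have e2 := chi_swap g k
  have e3 := chi_swap g h
  simp only [map_mul] at e1
  have c1 := conj_comm_right (chiIota1 G k) (chiIota2 G g) (chiIota1 G h)
  have c2 := conj_comm_right (chiIota2 G k) (chiIota1 G g) (chiIota2 G h)
  rw [e1, e2, e3, ← c2] at c1
  generalize ⁅chiIota1 G g, chiIota2 G h⁆ = z at *
  have hk := chi_comm G k
  generalize chiIota1 G k = a at *
  generalize chiIota2 G k = b at *
  calc a⁻¹ * b * z = a⁻¹ * (b * z * b⁻¹) * b := by group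
    _ = a⁻¹ * (a * z * a⁻¹) * b := by rw [c1]
    _ = _ := by group

theorem chi_mem_D {G : Type*} [Group G] (p q : Chi G →* G)
    (p1 : ∀ g, p (chiIota1 G g) = g) (p2 : ∀ g, p (chiIota2 G g) = 1)
    (q1 : ∀ g, q (chiIota1 G g) = 1) (q2 : ∀ g, q (chiIota2 G g) = g)
    {x : Chi G} (hp : p x = 1) (hq : q x = 1) : x ∈ chiD G := by
  have := chiD_normal G
  let m := QuotientGroup.mk' (chiD G)
  have hc : ∀ g h, Commute ((m.comp (chiIota1 G)) g) ((m.comp (chiIota2 G)) h) := by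
    intro g h
    have : m ⁅chiIota1 G g, chiIota2 G h⁆ = 1 :=
      (QuotientGroup.eq_one_iff _).2
        (Subgroup.commutator_mem_commutator ⟨g, rfl⟩ ⟨h, rfl⟩)
    rw [map_commutatorElement, commutatorElement_eq_one_iff_commute] at this
    exact this
  have key : (MonoidHom.noncommCoprod _ _ hc).comp (p.prod q) = m := by
    apply chi_hom_ext
    · intro g; simp [p1, q1]
    · intro g; simp [p2, q2]
  have := DFunLike.congr_fun key x
  simp [hp, hq] at this
  exact (QuotientGroup.eq_one_iff _).1 this.symm

theorem chiL_normal (G : Type*) [Group G] : (chiL G).Normal := by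
  have key : ∀ k : G, ∀ x ∈ chiL G, chiIota1 G k * x * (chiIota1 G k)⁻¹ ∈ chiL G := by
    intro k x hx
    have : chiL G ≤ (chiL G).comap (MulAut.conj (chiIota1 G k)).toMonoidHom := by
      refine (Subgroup.closure_le _).2 ?_
      rintro _ ⟨g, rfl⟩
      change chiIota1 G k * ((chiIota1 G g)⁻¹ * chiIota2 G g) * (chiIota1 G k)⁻¹ ∈ chiL G
      have h1 : (chiIota1 G (g * k⁻¹))⁻¹ * chiIota2 G (g * k⁻¹) ∈ chiL G :=
        Subgroup.subset_closure ⟨_, rfl⟩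
      have h2 : (chiIota1 G k⁻¹)⁻¹ * chiIota2 G k⁻¹ ∈ chiL G :=
        Subgroup.subset_closure ⟨_, rfl⟩
      have h3 := mul_mem h1 (inv_mem h2)
      simp only [map_mul, map_inv, mul_inv_rev, inv_inv] at h3
      convert h3 using 1
      group
    exact this hx
  have g1 : chiG1 G ≤ Subgroup.normalizer (chiL G : Set (Chi G)) := by
    rintro _ ⟨k, rfl⟩
    rw [Subgroup.mem_normalizer_iff]
    intro x
    refine ⟨key k x, fun hx => ?_⟩
    have := key k⁻¹ _ hx
    simpa [mul_assoc] using this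
  rw [← Subgroup.normalizer_eq_top_iff, eq_top_iff, ← chi_closure, sup_le_iff]
  refine ⟨g1, ?_⟩
  rintro _ ⟨k, rfl⟩
  have h : chiIota1 G k * ((chiIota1 G k)⁻¹ * chiIota2 G k) ∈
      Subgroup.normalizer (chiL G : Set (Chi G)) :=
    mul_mem (g1 ⟨k, rfl⟩) (Subgroup.le_normalizer (Subgroup.subset_closure ⟨k, rfl⟩))
  rwa [mul_inv_cancel_left] at h

theorem exists_finite_lift {X G : Type*} [Group X] [Group G] (p : X →* G) (A : Subgroup X)
    (hA : A.map p = commutator G) (hG' : Group.FG (commutator G)) :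
    ∃ S : Set X, S.Finite ∧ S ⊆ A ∧ (Subgroup.closure S).map p = commutator G := by
  obtain ⟨T, hT, hTf⟩ := (Subgroup.fg_iff _).1 ((Group.fg_iff_subgroup_fg _).1 hG')
  have hsub : T ⊆ Set.image p (A : Set X) := by
    rw [← Subgroup.coe_map, hA, ← hT]
    exact Subgroup.subset_closure
  choose! f hf using hsub
  have hS : Set.image p (Set.image f T) = T := by
    rw [Set.image_image]
    exact (Set.image_congr fun t ht => (hf ht).2).trans (Set.image_id' T)
  have hSA : Set.image f T ⊆ A := by
    rintro _ ⟨t, ht, rfl⟩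
    exact (hf ht).1
  exact ⟨Set.image f T, hTf.image f, hSA, by rw [MonoidHom.map_closure, hS, hT]⟩

theorem chiL12_fg (G : Type*) [Group G] (hG : Group.FG G)
    (hG' : Group.FG (commutator G)) : Group.FG (chiL12 G) := by
  obtain ⟨p, p1, p2⟩ := chi_lift_exists (MonoidHom.id G) (1 : G →* G) (by simp)
  obtain ⟨q, q1, q2⟩ := chi_lift_exists (1 : G →* G) (MonoidHom.id G) (by simp)
  simp only [MonoidHom.id_apply, MonoidHom.one_apply] at p1 p2 q1 q2
  have pG1 : (chiG1 G).map p = ⊤ := by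
    rw [eq_top_iff]; exact fun g _ => ⟨_, ⟨g, rfl⟩, p1 g⟩
  have pG2 : (chiG2 G).map p = ⊥ := by
    rw [eq_bot_iff]; rintro _ ⟨_, ⟨g, rfl⟩, rfl⟩; exact p2 g
  have qG2 : (chiG2 G).map q = ⊤ := by
    rw [eq_top_iff]; exact fun g _ => ⟨_, ⟨g, rfl⟩, q2 g⟩
  have qG1 : (chiG1 G).map q = ⊥ := by
    rw [eq_bot_iff]; rintro _ ⟨_, ⟨g, rfl⟩, rfl⟩; exact q1 g
  have pL : (chiL G).map p = ⊤ := by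
    rw [eq_top_iff]
    exact fun g _ => ⟨_, Subgroup.subset_closure ⟨g⁻¹, rfl⟩, by simp [p1, p2]⟩
  have qL : (chiL G).map q = ⊤ := by
    rw [eq_top_iff]
    exact fun g _ => ⟨_, Subgroup.subset_closure ⟨g, rfl⟩, by simp [q1, q2]⟩
  have pL1 : (chiL1 G).map p = commutator G := by
    rw [chiL1, Subgroup.map_commutator, pL, pG1]; rfl
  have qL2 : (chiL2 G).map q = commutator G := by
    rw [chiL2, Subgroup.map_commutator, qL, qG2]; rfl
  have qL1 : ∀ x ∈ chiL1 G, q x = 1 := by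
    intro x hx
    have : (chiL1 G).map q = ⊥ := by
      rw [chiL1, Subgroup.map_commutator, qG1, Subgroup.commutator_bot_right]
    exact Subgroup.mem_bot.1 (this ▸ Subgroup.mem_map_of_mem q hx)
  have pL2 : ∀ x ∈ chiL2 G, p x = 1 := by
    intro x hx
    have : (chiL2 G).map p = ⊥ := by
      rw [chiL2, Subgroup.map_commutator, pG2, Subgroup.commutator_bot_right]
    exact Subgroup.mem_bot.1 (this ▸ Subgroup.mem_map_of_mem p hx)
  have memD : ∀ x, p x = 1 → q x = 1 → x ∈ chiD G := fun x => chi_mem_D p q p1 p2 q1 q2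
  have := chiL_normal G
  have hL1 : chiL1 G ≤ chiL G := Subgroup.commutator_le_left _ _
  have hL2 : chiL2 G ≤ chiL G := Subgroup.commutator_le_left _ _
  have cD : ∀ x ∈ chiL1 G, ∀ y ∈ chiL2 G, ⁅x, y⁆ ∈ chiD G := by
    intro x hx y hy
    apply memD
    · simp [map_commutatorElement, pL2 y hy]
    · simp [map_commutatorElement, qL1 x hx]
  obtain ⟨S, hSf, hS, hSp⟩ := exists_finite_lift p _ pL1 hG'
  obtain ⟨T, hTf, hT, hTq⟩ := exists_finite_lift q _ qL2 hG'
  have hcS : Subgroup.closure S ≤ chiL1 G := (Subgroup.closure_le _).2 hS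
  have hcT : Subgroup.closure T ≤ chiL2 G := (Subgroup.closure_le _).2 hT
  set K := Subgroup.closure (Set.image2 (fun s t : Chi G => ⁅s, t⁆) S T) with hK
  -- additivity in each variable
  have addl : ∀ a ∈ chiL1 G, ∀ b ∈ chiL1 G, ∀ c ∈ chiL2 G, ⁅a * b, c⁆ = ⁅b, c⁆ * ⁅a, c⁆ := by
    intro a ha b hb c hc
    have h := conj_comm_left a b c
    rw [chi_L_comm_D (hL1 ha) (cD b hb c hc), mul_inv_cancel_right] at h
    rw [h, inv_mul_cancel_right]
  have addr : ∀ a ∈ chiL1 G, ∀ b ∈ chiL2 G, ∀ c ∈ chiL2 G, ⁅a, b * c⁆ = ⁅a, b⁆ * ⁅a, c⁆ := by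
    intro a ha b hb c hc
    have h := conj_comm_right b a c
    rw [chi_L_comm_D (hL2 hb) (cD a ha c hc), mul_inv_cancel_right] at h
    rw [h, mul_inv_cancel_left]
  have stepT : ∀ s ∈ S, ∀ t ∈ Subgroup.closure T, ⁅s, t⁆ ∈ K := by
    intro s hs t ht
    induction ht using Subgroup.closure_induction with
    | mem t ht => exact Subgroup.subset_closure ⟨s, hs, t, ht, rfl⟩
    | one => simp
    | mul a b ha hb iha ihb => 
      rw [addr s (hS hs) a (hcT ha) b (hcT hb)]; exact mul_mem iha ihb
    | inv a ha iha => 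
      have := addr s (hS hs) a (hcT ha) a⁻¹ (inv_mem (hcT ha))
      rw [mul_inv_cancel, commutatorElement_one_right] at this
      rw [← inv_eq_of_mul_eq_one_right this.symm]; exact inv_mem iha
  have stepS : ∀ s ∈ Subgroup.closure S, ∀ t ∈ Subgroup.closure T, ⁅s, t⁆ ∈ K := by
    intro s hs t ht
    induction hs using Subgroup.closure_induction with
    | mem s hs => exact stepT s hs t ht
    | one => simp
    | mul a b ha hb iha ihb => 
      rw [addl a (hcS ha) b (hcS hb) t (hcT ht)]; exact mul_mem ihb iha
    | inv a ha iha => 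
      have := addl a (hcS ha) a⁻¹ (inv_mem (hcS ha)) t (hcT ht)
      rw [mul_inv_cancel, commutatorElement_one_left] at this
      rw [← inv_eq_of_mul_eq_one_left this.symm]; exact inv_mem iha
  have hEq : chiL12 G = K := by
    apply le_antisymm
    · refine Subgroup.commutator_le.2 fun x hx y hy => ?_
      have hx' : p x ∈ (Subgroup.closure S).map p := by
        rw [hSp, ← pL1]; exact Subgroup.mem_map_of_mem p hx
      have hy' : q y ∈ (Subgroup.closure T).map q := by
        rw [hTq, ← qL2]; exact Subgroup.mem_map_of_mem q hy
      obtain ⟨s, hs, hsx⟩ := hx'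
      obtain ⟨t, ht, hty⟩ := hy'
      have hs1 : s ∈ chiL1 G := hcS hs
      have ht2 : t ∈ chiL2 G := hcT ht
      have hd1 : x * s⁻¹ ∈ chiL1 G := mul_mem hx (inv_mem hs1)
      have he2 : y * t⁻¹ ∈ chiL2 G := mul_mem hy (inv_mem ht2)
      have hd : x * s⁻¹ ∈ chiD G := memD _ (by simp [hsx]) (qL1 _ hd1)
      have he : y * t⁻¹ ∈ chiD G := memD _ (pL2 _ he2) (by simp [hty])
      have z1 : ⁅x * s⁻¹, y⁆ = 1 :=
        commutatorElement_eq_one_iff_mul_comm.2 (chi_L_comm_D (hL2 hy) hd).symm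
      have z2 : ⁅s, y * t⁻¹⁆ = 1 :=
        commutatorElement_eq_one_iff_mul_comm.2 (chi_L_comm_D (hL1 hs1) he)
      have e1 := addl _ hd1 s hs1 y hy
      have e2 := addr s hs1 _ he2 t ht2
      rw [inv_mul_cancel_right, z1, mul_one] at e1
      rw [inv_mul_cancel_right, z2, one_mul] at e2
      rw [e1, e2]
      exact stepS s hs t ht
    · refine (Subgroup.closure_le _).2 ?_
      rintro _ ⟨s, hs, t, ht, rfl⟩
      exact Subgroup.commutator_mem_commutator (hS hs) (hT ht)
  rw [Group.fg_iff_subgroup_fg, Subgroup.fg_iff]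
  exact ⟨_, hEq.symm, hSf.image2 _ hTf⟩
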